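/- arXiv:0807.2929 — 2 statements merged into one kernel-verified Lean document; each statement's English description precedes it below -/
import Mathlib

section
/- Let ω > 0, let y : ℝ → ℝ be infinitely differentiable, and let x ∈ ℝ. Let δ > 0 and let b0, b1, b2, b3 : {v : 0 < |v| < δ} → ℝ satisfy, for every v in the domain: N(v, b0(v), b1(v), b2(v), b3(v)) = 0, (∂N/∂v) = 0 and (∂²N/∂v²) = 0 at (v, b0(v), b1(v), b2(v), b3(v)), and b0(v) = 5 - 2·b1(v) - 2·b2(v) - 2·b3(v). Define, for 0 < |h| < δ/ω, L_h = y(x+4h) + y(x-4h) - 2(y(x+3h)+y(x-3h)) + 2(y(x+2h)+y(x-2h)) - (y(x+h)+y(x-h)) - h^2·[ b3(ωh)(y''(x+3h)+y''(x-3h)) + b2(ωh)(y''(x+2h)+y''(x-2h)) + b1(ωh)(y''(x+h)+y''(x-h)) + b0(ωh)·y''(x) ]. Then L_h / h^10 → (45767/725760)·( y^{(10)}(x) + 3·ω^2·y^{(8)}(x) + 3·ω^4·y^{(6)}(x) + ω^6·y^{(4)}(x) ) as h → 0 with h ≠ 0. -/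
/-- Phase-lag numerator of the symmetric 8-step method. -/
noncomputable def N (v b0 b1 b2 b3 : ℝ) : ℝ :=
  16 * Real.cos v ^ 4 + (8 * b3 * v ^ 2 - 16) * Real.cos v ^ 3
    + (4 * b2 * v ^ 2 - 8) * Real.cos v ^ 2
    + (10 + (2 * b1 - 6 * b3) * v ^ 2) * Real.cos v - 2
    + (b0 - 2 * b2) * v ^ 2

open Filter Topology Finset

/-- The remainder of the Taylor expansion of `t ↦ f (x + t)` at `t = c * h`, relative to `h ^ n`,
tends to zero. -/
lemma tendsto_taylor_remainder {f : ℝ → ℝ} {n : ℕ} (hf : ContDiff ℝ n f) (x c : ℝ) :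
    Tendsto (fun h => (f (x + c * h)
      - ∑ m ∈ range (n + 1), iteratedDeriv m f x * (c * h) ^ m / (m.factorial : ℝ)) / h ^ n)
      (𝓝[≠] 0) (𝓝 0) := by
  have hlim : Tendsto (fun h : ℝ => x + c * h) (𝓝 0) (𝓝 x) := by
    have : Continuous fun h : ℝ => x + c * h := by fun_prop
    simpa using this.tendsto 0
  have hO : (fun h : ℝ => (x + c * h - x) ^ n) =O[𝓝 0] fun h : ℝ => h ^ n := by
    simp only [add_sub_cancel_left]
    exact (Asymptotics.isBigO_const_mul_self c _ _).pow n
  have ho := (((taylor_isLittleO_univ (x₀ := x) hf).comp_tendsto hlim).trans_isBigO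
    hO).tendsto_div_nhds_zero.mono_left (nhdsWithin_le_nhds (s := {0}ᶜ))
  refine ho.congr fun h => ?_
  simp only [Function.comp_apply, taylor_within_apply, iteratedDerivWithin_univ,
    add_sub_cancel_left, smul_eq_mul]
  congr 2
  exact sum_congr rfl fun m _ => by ring

/-- The error, relative to `h ^ (2 * n)`, of the even Taylor expansion of
`f (x + c * h) + f (x - c * h)`. -/
noncomputable def symmRem (f : ℝ → ℝ) (x : ℝ) (n : ℕ) (c h : ℝ) : ℝ :=
  (f (x + c * h) + f (x - c * h)
    - 2 * ∑ k ∈ range (n + 1),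
      iteratedDeriv (2 * k) f x * (c * h) ^ (2 * k) / ((2 * k).factorial : ℝ)) / h ^ (2 * n)

lemma tendsto_symmRem {f : ℝ → ℝ} {n : ℕ} (hf : ContDiff ℝ (2 * n : ℕ) f) (x c : ℝ) :
    Tendsto (symmRem f x n c) (𝓝[≠] 0) (𝓝 0) := by
  have key := (tendsto_taylor_remainder hf x c).add (tendsto_taylor_remainder hf x (-c))
  rw [add_zero] at key
  refine key.congr fun h => ?_
  have hsum : ∀ n : ℕ,
      (∑ m ∈ range (2 * n + 1), iteratedDeriv m f x * (c * h) ^ m / (m.factorial : ℝ))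
        + ∑ m ∈ range (2 * n + 1), iteratedDeriv m f x * (-c * h) ^ m / (m.factorial : ℝ)
      = 2 * ∑ k ∈ range (n + 1),
        iteratedDeriv (2 * k) f x * (c * h) ^ (2 * k) / ((2 * k).factorial : ℝ) := by
    intro n
    induction n with
    | zero => simp; ring
    | succ n ih =>
      rw [sum_range_succ _ (n + 1), mul_add (2 : ℝ), ← ih, show 2 * (n + 1) + 1 = 2 * n + 1 + 1 + 1 by ring,
        sum_range_succ _ (2 * n + 1 + 1), sum_range_succ _ (2 * n + 1),
        sum_range_succ _ (2 * n + 1 + 1), sum_range_succ _ (2 * n + 1),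
        show 2 * n + 1 + 1 = 2 * (n + 1) by ring, neg_mul,
        Odd.neg_pow ⟨n, rfl⟩, Even.neg_pow (even_two_mul (n + 1))]
      ring
  rw [symmRem, ← hsum n, ← add_div, sub_eq_add_neg x, ← neg_mul]
  ring

/-- The error, relative to `v ^ (2 * n)`, of the Taylor polynomial of `cos (c * v)`. -/
noncomputable def cosRem (n : ℕ) (c v : ℝ) : ℝ :=
  (Real.cos (c * v)
    - ∑ k ∈ range (n + 1), (-1) ^ k * (c * v) ^ (2 * k) / ((2 * k).factorial : ℝ)) / v ^ (2 * n)

/-- The error, relative to `v ^ (2 * n + 1)`, of the Taylor polynomial of `sin (c * v)`. -/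
noncomputable def sinRem (n : ℕ) (c v : ℝ) : ℝ :=
  (Real.sin (c * v)
    - ∑ k ∈ range (n + 1), (-1) ^ k * (c * v) ^ (2 * k + 1) / ((2 * k + 1).factorial : ℝ))
    / v ^ (2 * n + 1)

lemma tendsto_cosRem (n : ℕ) (c : ℝ) : Tendsto (cosRem n c) (𝓝[≠] 0) (𝓝 0) := by
  have key := (tendsto_symmRem (n := n) Real.contDiff_cos 0 c).div_const 2
  rw [zero_div] at key
  refine key.congr fun v => ?_
  simp only [symmRem, cosRem, zero_add, zero_sub, Real.cos_neg, Real.iteratedDeriv_even_cos,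
    Pi.mul_apply, Pi.pow_apply, Pi.neg_apply, Pi.one_apply, Real.cos_zero, mul_one]
  ring

lemma tendsto_sinRem (n : ℕ) (c : ℝ) : Tendsto (sinRem n c) (𝓝[≠] 0) (𝓝 0) := by
  have key := tendsto_taylor_remainder (n := 2 * n + 1) Real.contDiff_sin 0 c
  refine key.congr fun v => ?_
  have hsum : ∀ n : ℕ,
      ∑ m ∈ range (2 * n), iteratedDeriv m Real.sin 0 * (c * v) ^ m / (m.factorial : ℝ)
      = ∑ k ∈ range n,
        (-1) ^ k * (c * v) ^ (2 * k + 1) / ((2 * k + 1).factorial : ℝ) := by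
    intro n
    induction n with
    | zero => simp
    | succ n ih =>
      rw [mul_add, mul_one, sum_range_succ _ (2 * n + 1), sum_range_succ _ (2 * n),
        sum_range_succ _ n, ih, Real.iteratedDeriv_even_sin, Real.iteratedDeriv_odd_sin]
      simp
  rw [sinRem, ← hsum (n + 1), zero_add]
  rfl

lemma tendsto_mulVec {α ι : Type*} [Fintype ι] {l : Filter α} {M : α → Matrix ι ι ℝ}
    {u : α → ι → ℝ} {M₀ : Matrix ι ι ℝ} {u₀ : ι → ℝ} (hM : Tendsto M l (𝓝 M₀))
    (hu : Tendsto u l (𝓝 u₀)) :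
    Tendsto (fun a => (M a).mulVec (u a)) l (𝓝 (M₀.mulVec u₀)) := by
  have h : Continuous fun p : Matrix ι ι ℝ × (ι → ℝ) => p.1.mulVec p.2 := by fun_prop
  exact (h.tendsto (M₀, u₀)).comp (hM.prodMk_nhds hu)

/-- If the coefficient matrices and right-hand sides of a family of linear systems converge and the
limit system is nonsingular, then the solutions converge to the solution of the limit system. -/
lemma tendsto_of_mulVec_eq {α ι : Type*} [Fintype ι] [DecidableEq ι] {l : Filter α}
    {M : α → Matrix ι ι ℝ} {u r : α → ι → ℝ} {M₀ : Matrix ι ι ℝ} {u₀ : ι → ℝ}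
    (hM : Tendsto M l (𝓝 M₀)) (hdet : M₀.det ≠ 0)
    (hr : Tendsto r l (𝓝 (M₀.mulVec u₀))) (h : ∀ᶠ a in l, (M a).mulVec (u a) = r a) :
    Tendsto u l (𝓝 u₀) := by
  have hdetM : Tendsto (fun a => (M a).det) l (𝓝 M₀.det) :=
    (continuous_id.matrix_det.tendsto M₀).comp hM
  have hinv : Tendsto (fun a => (M a)⁻¹) l (𝓝 M₀⁻¹) := by
    refine Tendsto.comp (continuousAt_matrix_inv M₀ ?_) hM
    rw [Ring.inverse_eq_inv']
    exact continuousAt_inv₀ hdet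
  have hmul := tendsto_mulVec hinv hr
  rw [Matrix.mulVec_mulVec, Matrix.nonsing_inv_mul _ (isUnit_iff_ne_zero.2 hdet),
    Matrix.one_mulVec] at hmul
  refine hmul.congr' ?_
  filter_upwards [h, hdetM.eventually_ne hdet] with a ha hda
  rw [← ha, Matrix.mulVec_mulVec, Matrix.nonsing_inv_mul _ (isUnit_iff_ne_zero.2 hda),
    Matrix.one_mulVec]

lemma N_eq_multiple_angle (b0 b1 b2 b3 w : ℝ) :
    N w b0 b1 b2 b3
      = 2 * Real.cos (4 * w) - 4 * Real.cos (3 * w) + 4 * Real.cos (2 * w) - 2 * Real.cos (1 * w)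
        + w ^ 2 * (2 * b3 * Real.cos (3 * w) + 2 * b2 * Real.cos (2 * w)
          + 2 * b1 * Real.cos (1 * w) + b0) := by
  rw [show 4 * w = 2 * (2 * w) by ring, Real.cos_two_mul (2 * w), Real.cos_two_mul,
    Real.cos_three_mul, one_mul, N]
  ring

lemma hasDerivAt_cos_const_mul (c w : ℝ) :
    HasDerivAt (fun w => Real.cos (c * w)) (-(c * Real.sin (c * w))) w := by
  have h := ((hasDerivAt_id w).const_mul c).cos
  simp only [id, mul_one] at h
  exact h.congr_deriv (by ring)

lemma hasDerivAt_sin_const_mul (c w : ℝ) :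
    HasDerivAt (fun w => Real.sin (c * w)) (c * Real.cos (c * w)) w := by
  have h := ((hasDerivAt_id w).const_mul c).sin
  simp only [id, mul_one] at h
  exact h.congr_deriv (by ring)

lemma deriv_N (b0 b1 b2 b3 : ℝ) :
    deriv (fun w => N w b0 b1 b2 b3) = fun w =>
      -8 * Real.sin (4 * w) + 12 * Real.sin (3 * w) - 8 * Real.sin (2 * w) + 2 * Real.sin (1 * w)
        + 2 * w * (2 * b3 * Real.cos (3 * w) + 2 * b2 * Real.cos (2 * w)
          + 2 * b1 * Real.cos (1 * w) + b0)
        - w ^ 2 * (6 * b3 * Real.sin (3 * w) + 4 * b2 * Real.sin (2 * w)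
          + 2 * b1 * Real.sin (1 * w)) := by
  funext w
  simp only [N_eq_multiple_angle]
  have hc := fun c => hasDerivAt_cos_const_mul c w
  refine HasDerivAt.deriv ((((((hc 4).const_mul 2).sub ((hc 3).const_mul 4)).add
    ((hc 2).const_mul 4)).sub ((hc 1).const_mul 2)).add ((hasDerivAt_pow 2 w).mul
    (((((hc 3).const_mul (2 * b3)).add ((hc 2).const_mul (2 * b2))).add
    ((hc 1).const_mul (2 * b1))).add_const b0)) |>.congr_deriv ?_)
  simp only [Pi.add_apply]
  push_cast
  ring

lemma iteratedDeriv_two_N (b0 b1 b2 b3 w : ℝ) :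
    iteratedDeriv 2 (fun w => N w b0 b1 b2 b3) w =
      -32 * Real.cos (4 * w) + 36 * Real.cos (3 * w) - 16 * Real.cos (2 * w)
        + 2 * Real.cos (1 * w)
        + 2 * (2 * b3 * Real.cos (3 * w) + 2 * b2 * Real.cos (2 * w)
          + 2 * b1 * Real.cos (1 * w) + b0)
        - 4 * w * (6 * b3 * Real.sin (3 * w) + 4 * b2 * Real.sin (2 * w)
          + 2 * b1 * Real.sin (1 * w))
        - w ^ 2 * (18 * b3 * Real.cos (3 * w) + 8 * b2 * Real.cos (2 * w)
          + 2 * b1 * Real.cos (1 * w)) := by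
  rw [iteratedDeriv_succ, iteratedDeriv_one, deriv_N]
  have hc := fun c => hasDerivAt_cos_const_mul c w
  have hs := fun c => hasDerivAt_sin_const_mul c w
  refine HasDerivAt.deriv ((((((((hs 4).const_mul (-8)).add ((hs 3).const_mul 12)).sub
    ((hs 2).const_mul 8)).add ((hs 1).const_mul 2)).add
    (((hasDerivAt_id w).const_mul 2).mul
    (((((hc 3).const_mul (2 * b3)).add ((hc 2).const_mul (2 * b2))).add
    ((hc 1).const_mul (2 * b1))).add_const b0))).sub ((hasDerivAt_pow 2 w).mul
    ((((hs 3).const_mul (6 * b3)).add ((hs 2).const_mul (4 * b2))).add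
    ((hs 1).const_mul (2 * b1))))) |>.congr_deriv ?_)
  simp only [id, Pi.add_apply]
  push_cast
  ring


/-- The coefficient of `h ^ (2 * k + 2) * y⁽²ᵏ⁺²⁾(x)` in the expansion of the local truncation error
of the method with weights `b1`, `b2`, `b3`. -/
noncomputable def lteCoeff (b1 b2 b3 : ℝ) (k : ℕ) : ℝ :=
  (2 * 4 ^ (2 * k + 2) - 4 * 3 ^ (2 * k + 2) + 4 * 2 ^ (2 * k + 2) - 2)
      / ((2 * k + 2).factorial : ℝ)
    - 2 * (b1 + 4 ^ k * b2 + 9 ^ k * b3) / ((2 * k).factorial : ℝ)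

lemma lteCoeff_four_eq (b1 b2 b3 : ℝ) :
    lteCoeff b1 b2 b3 4 = 45767 / 725760 + lteCoeff b1 b2 b3 1 / 560
      - 7 / 240 * lteCoeff b1 b2 b3 2 + lteCoeff b1 b2 b3 3 / 4 := by
  norm_num [lteCoeff, Nat.factorial]
  ring

lemma weight_one_eq (b1 b2 b3 : ℝ) :
    b1 = 20483 / 4032 - 3 / 2 * lteCoeff b1 b2 b3 1 + 13 / 2 * lteCoeff b1 b2 b3 2
      - 15 * lteCoeff b1 b2 b3 3 := by
  norm_num [lteCoeff, Nat.factorial]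
  ring

lemma weight_two_eq (b1 b2 b3 : ℝ) :
    b2 = -3937 / 2016 + 3 / 20 * lteCoeff b1 b2 b3 1 - 2 * lteCoeff b1 b2 b3 2
      + 6 * lteCoeff b1 b2 b3 3 := by
  norm_num [lteCoeff, Nat.factorial]
  ring

lemma weight_three_eq (b1 b2 b3 : ℝ) :
    b3 = 17671 / 12096 - lteCoeff b1 b2 b3 1 / 90 + lteCoeff b1 b2 b3 2 / 6
      - lteCoeff b1 b2 b3 3 := by
  norm_num [lteCoeff, Nat.factorial]
  ring

/-- The factors produced by applying `v ^ i * (d/dv) ^ i` to `v ^ 4`, `v ^ 6`, `v ^ 8`, `v ^ 10`. -/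
def eulerFactor : Matrix (Fin 3) (Fin 4) ℝ :=
  !![1, 1, 1, 1; 4, 6, 8, 10; 12, 30, 56, 90]

/-- The Taylor remainders in the expansion of `v ^ i * (∂/∂v) ^ i N / v ^ 10`: column `0` is the part
independent of the weights, column `j` the factor of the weight `bj`. -/
noncomputable def phaseLagRem (v : ℝ) : Matrix (Fin 3) (Fin 4) ℝ :=
  !![2 * cosRem 5 4 v - 4 * cosRem 5 3 v + 4 * cosRem 5 2 v - 2 * cosRem 5 1 v,
      2 * cosRem 4 1 v, 2 * cosRem 4 2 v, 2 * cosRem 4 3 v;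
    -8 * sinRem 4 4 v + 12 * sinRem 4 3 v - 8 * sinRem 4 2 v + 2 * sinRem 4 1 v,
      4 * cosRem 4 1 v - 2 * sinRem 3 1 v, 4 * cosRem 4 2 v - 4 * sinRem 3 2 v,
      4 * cosRem 4 3 v - 6 * sinRem 3 3 v;
    -32 * cosRem 4 4 v + 36 * cosRem 4 3 v - 16 * cosRem 4 2 v + 2 * cosRem 4 1 v,
      4 * cosRem 4 1 v - 8 * sinRem 3 1 v - 2 * cosRem 3 1 v,
      4 * cosRem 4 2 v - 16 * sinRem 3 2 v - 8 * cosRem 3 2 v,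
      4 * cosRem 4 3 v - 24 * sinRem 3 3 v - 18 * cosRem 3 3 v]

lemma tendsto_phaseLagRem (i : Fin 3) (j : Fin 4) :
    Tendsto (fun v => phaseLagRem v i j) (𝓝[≠] 0) (𝓝 0) := by
  have hlin : ∀ {f g p q : ℝ → ℝ} (a b c d : ℝ), Tendsto f (𝓝[≠] 0) (𝓝 0) →
      Tendsto g (𝓝[≠] 0) (𝓝 0) → Tendsto p (𝓝[≠] 0) (𝓝 0) → Tendsto q (𝓝[≠] 0) (𝓝 0) →
      Tendsto (fun v => a * f v + b * g v + c * p v + d * q v) (𝓝[≠] 0) (𝓝 0) := by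
    intro f g p q a b c d hf hg hp hq
    simpa using (((hf.const_mul a).add (hg.const_mul b)).add (hp.const_mul c)).add (hq.const_mul d)
  have hc := tendsto_cosRem
  have hs := tendsto_sinRem
  fin_cases i <;> fin_cases j <;> simp only [phaseLagRem]
  · exact (hlin 2 (-4) 4 (-2) (hc 5 4) (hc 5 3) (hc 5 2) (hc 5 1)).congr fun v => by simp; ring
  · exact (hlin 2 0 0 0 (hc 4 1) (hc 4 1) (hc 4 1) (hc 4 1)).congr fun v => by simp
  · exact (hlin 2 0 0 0 (hc 4 2) (hc 4 1) (hc 4 1) (hc 4 1)).congr fun v => by simp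
  · exact (hlin 2 0 0 0 (hc 4 3) (hc 4 1) (hc 4 1) (hc 4 1)).congr fun v => by simp
  · exact (hlin (-8) 12 (-8) 2 (hs 4 4) (hs 4 3) (hs 4 2) (hs 4 1)).congr fun v => by simp; ring
  · exact (hlin 4 (-2) 0 0 (hc 4 1) (hs 3 1) (hc 4 1) (hc 4 1)).congr fun v => by simp; ring
  · exact (hlin 4 (-4) 0 0 (hc 4 2) (hs 3 2) (hc 4 1) (hc 4 1)).congr fun v => by simp; ring
  · exact (hlin 4 (-6) 0 0 (hc 4 3) (hs 3 3) (hc 4 1) (hc 4 1)).congr fun v => by simp; ring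
  · exact (hlin (-32) 36 (-16) 2 (hc 4 4) (hc 4 3) (hc 4 2) (hc 4 1)).congr fun v => by simp; ring
  · exact (hlin 4 (-8) (-2) 0 (hc 4 1) (hs 3 1) (hc 3 1) (hc 4 1)).congr fun v => by simp; ring
  · exact (hlin 4 (-16) (-8) 0 (hc 4 2) (hs 3 2) (hc 3 2) (hc 4 1)).congr fun v => by simp; ring
  · exact (hlin 4 (-24) (-18) 0 (hc 4 3) (hs 3 3) (hc 3 3) (hc 4 1)).congr fun v => by simp; ring

lemma cos_eq_add_cosRem (n : ℕ) (c : ℝ) {v : ℝ} (hv : v ≠ 0) :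
    Real.cos (c * v) = ∑ k ∈ range (n + 1), (-1) ^ k * (c * v) ^ (2 * k) / ((2 * k).factorial : ℝ)
      + v ^ (2 * n) * cosRem n c v := by
  rw [cosRem, mul_div_cancel₀ _ (pow_ne_zero _ hv)]
  ring

lemma sin_eq_add_sinRem (n : ℕ) (c : ℝ) {v : ℝ} (hv : v ≠ 0) :
    Real.sin (c * v)
      = ∑ k ∈ range (n + 1), (-1) ^ k * (c * v) ^ (2 * k + 1) / ((2 * k + 1).factorial : ℝ)
        + v ^ (2 * n + 1) * sinRem n c v := by
  rw [sinRem, mul_div_cancel₀ _ (pow_ne_zero _ hv)]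
  ring

/-- The expansion of `v ^ i * (∂/∂v) ^ i N` for a consistent method, up to order `v ^ 10`. -/
lemma pow_mul_iteratedDeriv_N (i : Fin 3) {v : ℝ} (hv : v ≠ 0) {b0 b1 b2 b3 : ℝ}
    (hb0 : b0 = 5 - 2 * b1 - 2 * b2 - 2 * b3) :
    v ^ (i : ℕ) * iteratedDeriv i (fun w => N w b0 b1 b2 b3) v
      = eulerFactor i 0 * lteCoeff b1 b2 b3 1 * v ^ 4 - eulerFactor i 1 * lteCoeff b1 b2 b3 2 * v ^ 6
        + eulerFactor i 2 * lteCoeff b1 b2 b3 3 * v ^ 8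
        - eulerFactor i 3 * lteCoeff b1 b2 b3 4 * v ^ 10
        + v ^ 10 * (phaseLagRem v i 0 + b1 * phaseLagRem v i 1 + b2 * phaseLagRem v i 2
          + b3 * phaseLagRem v i 3) := by
  have hc5 := fun c => cos_eq_add_cosRem 5 c hv
  have hc4 := fun c => cos_eq_add_cosRem 4 c hv
  have hc3 := fun c => cos_eq_add_cosRem 3 c hv
  have hs4 := fun c => sin_eq_add_sinRem 4 c hv
  have hs3 := fun c => sin_eq_add_sinRem 3 c hv
  simp only [sum_range_succ, sum_range_zero, Nat.reduceMul, Nat.reduceAdd] at hc5 hc4 hc3 hs4 hs3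
  norm_num [Nat.factorial] at hc5 hc4 hc3 hs4 hs3
  have hc5' := hc5 1
  have hc4' := hc4 1
  have hc3' := hc3 1
  have hs4' := hs4 1
  have hs3' := hs3 1
  simp only [one_mul] at hc5' hc4' hc3' hs4' hs3'
  subst hb0
  fin_cases i
  · simp only [Fin.zero_eta, iteratedDeriv_zero,
      N_eq_multiple_angle, eulerFactor, phaseLagRem, Matrix.of_apply, Matrix.cons_val]
    norm_num [lteCoeff, Nat.factorial]
    linear_combination 2 * hc5 4 - 4 * hc5 3 + 4 * hc5 2 - 2 * hc5'
      + v ^ 2 * (2 * b3 * hc4 3 + 2 * b2 * hc4 2 + 2 * b1 * hc4')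
  · simp only [Fin.mk_one, iteratedDeriv_one,
      deriv_N, eulerFactor, phaseLagRem, Matrix.of_apply, Matrix.cons_val]
    norm_num [lteCoeff, Nat.factorial]
    linear_combination v * (-8 * hs4 4 + 12 * hs4 3 - 8 * hs4 2 + 2 * hs4')
      + 2 * v ^ 2 * (2 * b3 * hc4 3 + 2 * b2 * hc4 2 + 2 * b1 * hc4')
      - v ^ 3 * (6 * b3 * hs3 3 + 4 * b2 * hs3 2 + 2 * b1 * hs3')
  · simp only [Fin.reduceFinMk, iteratedDeriv_two_N,
      eulerFactor, phaseLagRem, Matrix.of_apply, Matrix.cons_val]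
    norm_num [lteCoeff, Nat.factorial]
    linear_combination v ^ 2 * (-32 * hc4 4 + 36 * hc4 3 - 16 * hc4 2 + 2 * hc4')
      + 2 * v ^ 2 * (2 * b3 * hc4 3 + 2 * b2 * hc4 2 + 2 * b1 * hc4')
      - 4 * v ^ 3 * (6 * b3 * hs3 3 + 4 * b2 * hs3 2 + 2 * b1 * hs3')
      - v ^ 4 * (18 * b3 * hc3 3 + 8 * b2 * hc3 2 + 2 * b1 * hc3')

/-- Column `k` of the linear system satisfied by the scaled coefficients `lteCoeff (k + 1)`. -/
noncomputable def phaseLagMatrix (v : ℝ) : Matrix (Fin 3) (Fin 3) ℝ :=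
  Matrix.of fun i =>
    ![eulerFactor i 0 + v ^ 6 * (-eulerFactor i 3 / 560 - 3 / 2 * phaseLagRem v i 1
        + 3 / 20 * phaseLagRem v i 2 - 1 / 90 * phaseLagRem v i 3),
      -eulerFactor i 1 + v ^ 4 * (7 / 240 * eulerFactor i 3 + 13 / 2 * phaseLagRem v i 1
        - 2 * phaseLagRem v i 2 + 1 / 6 * phaseLagRem v i 3),
      eulerFactor i 2 + v ^ 2 * (-eulerFactor i 3 / 4 - 15 * phaseLagRem v i 1
        + 6 * phaseLagRem v i 2 - phaseLagRem v i 3)]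

/-- The right-hand side of the linear system satisfied by the scaled coefficients. -/
noncomputable def phaseLagRhs (v : ℝ) : Fin 3 → ℝ := fun i =>
  45767 / 725760 * eulerFactor i 3 - phaseLagRem v i 0 - 20483 / 4032 * phaseLagRem v i 1
    + 3937 / 2016 * phaseLagRem v i 2 - 17671 / 12096 * phaseLagRem v i 3

lemma phaseLagMatrix_mulVec {v : ℝ} (hv : v ≠ 0) {b0 b1 b2 b3 : ℝ}
    (hb0 : b0 = 5 - 2 * b1 - 2 * b2 - 2 * b3)
    (hN : ∀ i : Fin 3, iteratedDeriv i (fun w => N w b0 b1 b2 b3) v = 0) :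
    (phaseLagMatrix v).mulVec ![lteCoeff b1 b2 b3 1 / v ^ 6, lteCoeff b1 b2 b3 2 / v ^ 4,
      lteCoeff b1 b2 b3 3 / v ^ 2] = phaseLagRhs v := by
  funext i
  have hrow := pow_mul_iteratedDeriv_N i hv hb0
  rw [hN i, mul_zero] at hrow
  have h1 := weight_one_eq b1 b2 b3
  have h2 := weight_two_eq b1 b2 b3
  have h3 := weight_three_eq b1 b2 b3
  have h4 := lteCoeff_four_eq b1 b2 b3
  obtain ⟨x2, hx2⟩ : ∃ t, t = lteCoeff b1 b2 b3 1 / v ^ 6 := ⟨_, rfl⟩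
  obtain ⟨x3, hx3⟩ : ∃ t, t = lteCoeff b1 b2 b3 2 / v ^ 4 := ⟨_, rfl⟩
  obtain ⟨x4, hx4⟩ : ∃ t, t = lteCoeff b1 b2 b3 3 / v ^ 2 := ⟨_, rfl⟩
  rw [← hx2, ← hx3, ← hx4]
  rw [eq_div_iff (pow_ne_zero _ hv)] at hx2 hx3 hx4
  rw [← hx2, ← hx3, ← hx4] at h1 h2 h3 h4
  rw [← hx2, ← hx3, ← hx4] at hrow
  refine mul_left_cancel₀ (pow_ne_zero 10 hv) ?_
  simp only [Matrix.mulVec, dotProduct, Fin.sum_univ_three, phaseLagMatrix, phaseLagRhs,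
    Matrix.of_apply, Matrix.cons_val]
  linear_combination -hrow + v ^ 10 * (eulerFactor i 3 * h4 - phaseLagRem v i 1 * h1
    - phaseLagRem v i 2 * h2 - phaseLagRem v i 3 * h3)

lemma tendsto_phaseLagMatrix :
    Tendsto phaseLagMatrix (𝓝[≠] 0) (𝓝 !![1, -1, 1; 4, -6, 8; 12, -30, 56]) := by
  have hpow : ∀ n : ℕ, n ≠ 0 → Tendsto (fun v : ℝ => v ^ n) (𝓝[≠] 0) (𝓝 0) := fun n hn => by
    simpa [hn] using ((continuous_pow n).tendsto (0 : ℝ)).mono_left nhdsWithin_le_nhds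
  have hcol : ∀ (n : ℕ) (i : Fin 3) (e s a b c : ℝ), n ≠ 0 →
      Tendsto (fun v => e + v ^ n * (s + a * phaseLagRem v i 1 + b * phaseLagRem v i 2
        + c * phaseLagRem v i 3)) (𝓝[≠] 0) (𝓝 e) := fun n i e s a b c hn => by
    simpa using ((hpow n hn).mul (((((tendsto_phaseLagRem i 1).const_mul a).const_add s).add
      ((tendsto_phaseLagRem i 2).const_mul b)).add
      ((tendsto_phaseLagRem i 3).const_mul c))).const_add e
  refine tendsto_pi_nhds.2 fun i => tendsto_pi_nhds.2 fun j => ?_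
  have h0 := hcol 6 i (eulerFactor i 0) (-eulerFactor i 3 / 560) (-3 / 2) (3 / 20) (-1 / 90)
    (by norm_num)
  have h1 := hcol 4 i (-eulerFactor i 1) (7 / 240 * eulerFactor i 3) (13 / 2) (-2) (1 / 6)
    (by norm_num)
  have h2 := hcol 2 i (eulerFactor i 2) (-eulerFactor i 3 / 4) (-15) 6 (-1) (by norm_num)
  have hlim : (!![1, -1, 1; 4, -6, 8; 12, -30, 56] : Matrix (Fin 3) (Fin 3) ℝ) i
      = ![eulerFactor i 0, -eulerFactor i 1, eulerFactor i 2] := by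
    funext j
    fin_cases i <;> fin_cases j <;> simp [eulerFactor]
  rw [hlim]
  fin_cases j
  · exact h0.congr fun v => by
      simp only [phaseLagMatrix, Fin.zero_eta, Matrix.of_apply, Matrix.cons_val]
      ring
  · exact h1.congr fun v => by
      simp only [phaseLagMatrix, Fin.mk_one, Matrix.of_apply, Matrix.cons_val]
      ring
  · exact h2.congr fun v => by
      simp only [phaseLagMatrix, Fin.reduceFinMk, Matrix.of_apply, Matrix.cons_val]
      ring

lemma tendsto_phaseLagRhs :
    Tendsto phaseLagRhs (𝓝[≠] 0) (𝓝 fun i => 45767 / 725760 * eulerFactor i 3) := by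
  refine tendsto_pi_nhds.2 fun i => ?_
  have hr := tendsto_phaseLagRem i
  simpa [phaseLagRhs] using ((((hr 0).const_sub (45767 / 725760 * eulerFactor i 3)).sub
    ((hr 1).const_mul (20483 / 4032))).add ((hr 2).const_mul (3937 / 2016))).sub
    ((hr 3).const_mul (17671 / 12096))

/-- The error coefficients of the methods with vanishing phase-lag and first two derivatives of the
phase-lag, scaled by powers of `v`. -/
lemma tendsto_scaled_lteCoeff {δ : ℝ} (hδ : 0 < δ) {b0 b1 b2 b3 : ℝ → ℝ}
    (hcond : ∀ v : ℝ, 0 < |v| → |v| < δ →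
      (∀ i : Fin 3, iteratedDeriv i (fun w => N w (b0 v) (b1 v) (b2 v) (b3 v)) v = 0) ∧
      b0 v = 5 - 2 * b1 v - 2 * b2 v - 2 * b3 v) :
    Tendsto (fun v => ![lteCoeff (b1 v) (b2 v) (b3 v) 1 / v ^ 6,
        lteCoeff (b1 v) (b2 v) (b3 v) 2 / v ^ 4, lteCoeff (b1 v) (b2 v) (b3 v) 3 / v ^ 2])
      (𝓝[≠] 0) (𝓝 ![45767 / 725760, 3 * (45767 / 725760), 3 * (45767 / 725760)]) := by
  refine tendsto_of_mulVec_eq (r := phaseLagRhs) tendsto_phaseLagMatrix ?_ ?_ ?_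
  · simp only [Matrix.det_fin_three, Matrix.of_apply, Matrix.cons_val]
    norm_num
  · convert tendsto_phaseLagRhs using 2
    funext i
    fin_cases i <;>
      simp only [eulerFactor, Matrix.mulVec, dotProduct, Fin.sum_univ_three, Fin.zero_eta,
        Fin.mk_one, Fin.reduceFinMk, Matrix.of_apply, Matrix.cons_val] <;>
      norm_num
  · have hsmall : ∀ᶠ v : ℝ in 𝓝[≠] 0, |v| < δ :=
      nhdsWithin_le_nhds (continuous_abs.tendsto' (0 : ℝ) 0 abs_zero |>.eventually_lt_const hδ)
    filter_upwards [hsmall, self_mem_nhdsWithin] with v hvδ hv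
    obtain ⟨hN, hb0⟩ := hcond v (abs_pos.2 hv) hvδ
    exact phaseLagMatrix_mulVec hv hb0 hN

lemma add_eq_symmRem (f : ℝ → ℝ) (x : ℝ) (n : ℕ) (c : ℝ) {h : ℝ} (hh : h ≠ 0) :
    f (x + c * h) + f (x - c * h)
      = 2 * ∑ k ∈ range (n + 1),
          iteratedDeriv (2 * k) f x * (c * h) ^ (2 * k) / ((2 * k).factorial : ℝ)
        + h ^ (2 * n) * symmRem f x n c h := by
  rw [symmRem, mul_div_cancel₀ _ (pow_ne_zero _ hh)]
  ring

/-- The expansion of the local truncation error of a consistent method, up to order `h ^ 10`. -/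
lemma localTruncationError_eq (y : ℝ → ℝ) (x : ℝ) {h b0 b1 b2 b3 : ℝ} (hh : h ≠ 0)
    (hb0 : b0 = 5 - 2 * b1 - 2 * b2 - 2 * b3) :
    (y (x + 4 * h) + y (x - 4 * h) - 2 * (y (x + 3 * h) + y (x - 3 * h))
        + 2 * (y (x + 2 * h) + y (x - 2 * h)) - (y (x + h) + y (x - h))
        - h ^ 2 *
          (b3 * (iteratedDeriv 2 y (x + 3 * h) + iteratedDeriv 2 y (x - 3 * h))
            + b2 * (iteratedDeriv 2 y (x + 2 * h) + iteratedDeriv 2 y (x - 2 * h))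
            + b1 * (iteratedDeriv 2 y (x + h) + iteratedDeriv 2 y (x - h))
            + b0 * iteratedDeriv 2 y x)) / h ^ 10
      = lteCoeff b1 b2 b3 4 * iteratedDeriv 10 y x
        + lteCoeff b1 b2 b3 3 / h ^ 2 * iteratedDeriv 8 y x
        + lteCoeff b1 b2 b3 2 / h ^ 4 * iteratedDeriv 6 y x
        + lteCoeff b1 b2 b3 1 / h ^ 6 * iteratedDeriv 4 y x
        + (symmRem y x 5 4 h - 2 * symmRem y x 5 3 h + 2 * symmRem y x 5 2 h - symmRem y x 5 1 h)
        - (b3 * symmRem (iteratedDeriv 2 y) x 4 3 h + b2 * symmRem (iteratedDeriv 2 y) x 4 2 h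
          + b1 * symmRem (iteratedDeriv 2 y) x 4 1 h) := by
  have hy := fun c => add_eq_symmRem y x 5 c hh
  have hy2 := fun c => add_eq_symmRem (iteratedDeriv 2 y) x 4 c hh
  have hiter : ∀ m, iteratedDeriv m (iteratedDeriv 2 y) x = iteratedDeriv (m + 2) y x := fun m => by
    simp only [iteratedDeriv_eq_iterate, Function.iterate_add_apply]
  simp only [hiter, sum_range_succ, sum_range_zero, Nat.reduceMul, Nat.reduceAdd] at hy hy2
  norm_num [Nat.factorial] at hy hy2
  have hy' := hy 1
  have hy2' := hy2 1
  simp only [one_mul] at hy' hy2'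
  rw [hy 4, hy 3, hy 2, hy', hy2 3, hy2 2, hy2', hb0]
  norm_num [lteCoeff, Nat.factorial]
  field_simp
  ring

/-- The principal term of the local truncation error of the method with zero
phase-lag and zero first and second derivatives of the phase-lag is
`(45767/725760) · h^10 · (y⁽¹⁰⁾ + 3ω² y⁽⁸⁾ + 3ω⁴ y⁽⁶⁾ + ω⁶ y⁽⁴⁾)`. -/
theorem zero_PL_PL'_PL''_method_principal_LTE
    (ω : ℝ) (hω : 0 < ω) (y : ℝ → ℝ) (hy : ContDiff ℝ (⊤ : ℕ∞) y) (x : ℝ)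
    (δ : ℝ) (hδ : 0 < δ) (b0 b1 b2 b3 : ℝ → ℝ)
    (hcond : ∀ v : ℝ, 0 < |v| → |v| < δ →
      N v (b0 v) (b1 v) (b2 v) (b3 v) = 0 ∧
      deriv (fun w => N w (b0 v) (b1 v) (b2 v) (b3 v)) v = 0 ∧
      iteratedDeriv 2 (fun w => N w (b0 v) (b1 v) (b2 v) (b3 v)) v = 0 ∧
      b0 v = 5 - 2 * b1 v - 2 * b2 v - 2 * b3 v) :
    Filter.Tendsto
      (fun h : ℝ =>
        (y (x + 4 * h) + y (x - 4 * h)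
          - 2 * (y (x + 3 * h) + y (x - 3 * h))
          + 2 * (y (x + 2 * h) + y (x - 2 * h))
          - (y (x + h) + y (x - h))
          - h ^ 2 *
            (b3 (ω * h) * (iteratedDeriv 2 y (x + 3 * h) + iteratedDeriv 2 y (x - 3 * h))
              + b2 (ω * h) * (iteratedDeriv 2 y (x + 2 * h) + iteratedDeriv 2 y (x - 2 * h))
              + b1 (ω * h) * (iteratedDeriv 2 y (x + h) + iteratedDeriv 2 y (x - h))
              + b0 (ω * h) * iteratedDeriv 2 y x)) / h ^ 10)
      (nhdsWithin 0 {(0 : ℝ)}ᶜ)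
      (nhds ((45767 / 725760) *
        (iteratedDeriv 10 y x + 3 * ω ^ 2 * iteratedDeriv 8 y x
          + 3 * ω ^ 4 * iteratedDeriv 6 y x + ω ^ 6 * iteratedDeriv 4 y x))) := by
  have hcond' : ∀ v : ℝ, 0 < |v| → |v| < δ →
      (∀ i : Fin 3, iteratedDeriv i (fun w => N w (b0 v) (b1 v) (b2 v) (b3 v)) v = 0) ∧
      b0 v = 5 - 2 * b1 v - 2 * b2 v - 2 * b3 v := by
    intro v hv hvδ
    obtain ⟨h0, h1, h2, hb⟩ := hcond v hv hvδ
    refine ⟨fun i => ?_, hb⟩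
    fin_cases i
    · simpa using h0
    · simpa using h1
    · exact h2
  have hωh : Tendsto (fun h : ℝ => ω * h) (𝓝[≠] 0) (𝓝[≠] 0) := by
    refine tendsto_nhdsWithin_of_tendsto_nhds_of_eventually_within _ ?_ ?_
    · exact ((continuous_const_mul ω).tendsto' 0 0 (mul_zero ω)).mono_left nhdsWithin_le_nhds
    · filter_upwards [self_mem_nhdsWithin] with h hh using mul_ne_zero hω.ne' hh
  have hscaled := tendsto_pi_nhds.1 ((tendsto_scaled_lteCoeff hδ hcond').comp hωh)
  set G : ℕ → ℝ → ℝ := fun k h => lteCoeff (b1 (ω * h)) (b2 (ω * h)) (b3 (ω * h)) k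
  have hdiv : ∀ (k n : ℕ) (L : ℝ), Tendsto (fun h => G k h / (ω * h) ^ n) (𝓝[≠] 0) (𝓝 L) →
      Tendsto (fun h => G k h / h ^ n) (𝓝[≠] 0) (𝓝 (ω ^ n * L)) := by
    intro k n L hL
    refine (hL.const_mul (ω ^ n)).congr fun h => ?_
    have := pow_ne_zero n hω.ne'
    rw [mul_pow]
    field_simp
  have hG1 := hdiv 1 6 _ (hscaled 0)
  have hG2 := hdiv 2 4 _ (hscaled 1)
  have hG3 := hdiv 3 2 _ (hscaled 2)
  simp only [Matrix.cons_val] at hG1 hG2 hG3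
  have hzero : ∀ (k n : ℕ) (L : ℝ), n ≠ 0 → Tendsto (fun h => G k h / h ^ n) (𝓝[≠] 0) (𝓝 L) →
      Tendsto (G k) (𝓝[≠] 0) (𝓝 0) := by
    intro k n L hn hL
    have hpow : Tendsto (fun h : ℝ => h ^ n) (𝓝[≠] 0) (𝓝 0) :=
      ((continuous_pow n).tendsto' (0 : ℝ) 0 (zero_pow hn)).mono_left nhdsWithin_le_nhds
    have hmul := hL.mul hpow
    rw [mul_zero] at hmul
    refine hmul.congr' ?_
    filter_upwards [self_mem_nhdsWithin] with h hh
    exact div_mul_cancel₀ _ (pow_ne_zero n hh)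
  have hZ1 := hzero 1 6 _ (by norm_num) hG1
  have hZ2 := hzero 2 4 _ (by norm_num) hG2
  have hZ3 := hzero 3 2 _ (by norm_num) hG3
  have hG4 : Tendsto (G 4) (𝓝[≠] 0) (𝓝 (45767 / 725760)) := by
    have hlim := (((hZ1.div_const 560).const_add (45767 / 725760)).sub
      (hZ2.const_mul (7 / 240))).add (hZ3.div_const 4)
    simp only [zero_div, mul_zero, add_zero, sub_zero] at hlim
    exact hlim.congr fun h => (lteCoeff_four_eq _ _ _).symm
  have hb1 : Tendsto (fun h => b1 (ω * h)) (𝓝[≠] 0) (𝓝 _) :=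
    (((hZ1.const_mul (3 / 2)).const_sub (20483 / 4032)).add (hZ2.const_mul (13 / 2))).sub
      (hZ3.const_mul 15) |>.congr fun h => (weight_one_eq _ _ _).symm
  have hb2 : Tendsto (fun h => b2 (ω * h)) (𝓝[≠] 0) (𝓝 _) :=
    (((hZ1.const_mul (3 / 20)).const_add (-3937 / 2016)).sub (hZ2.const_mul 2)).add
      (hZ3.const_mul 6) |>.congr fun h => (weight_two_eq _ _ _).symm
  have hb3 : Tendsto (fun h => b3 (ω * h)) (𝓝[≠] 0) (𝓝 _) :=
    (((hZ1.div_const 90).const_sub (17671 / 12096)).add (hZ2.div_const 6)).sub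
      hZ3 |>.congr fun h => (weight_three_eq _ _ _).symm
  have hsymm : ∀ c : ℝ, Tendsto (symmRem y x 5 c) (𝓝[≠] 0) (𝓝 0) := fun c =>
    tendsto_symmRem (contDiff_infty.1 hy _) x c
  have hsymm2 : ∀ c : ℝ, Tendsto (symmRem (iteratedDeriv 2 y) x 4 c) (𝓝[≠] 0) (𝓝 0) := fun c =>
    tendsto_symmRem (by
      rw [iteratedDeriv_eq_iterate]
      exact (contDiff_infty.1 hy (8 + 2)).iterate_deriv' 8 2) x c
  have hlim := (((((hG4.mul_const (iteratedDeriv 10 y x)).add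
    (hG3.mul_const (iteratedDeriv 8 y x))).add (hG2.mul_const (iteratedDeriv 6 y x))).add
    (hG1.mul_const (iteratedDeriv 4 y x))).add
    ((((hsymm 4).sub ((hsymm 3).const_mul 2)).add ((hsymm 2).const_mul 2)).sub (hsymm 1))).sub
    (((hb3.mul (hsymm2 3)).add (hb2.mul (hsymm2 2))).add (hb1.mul (hsymm2 1)))
  simp only [mul_zero, add_zero, sub_zero] at hlim
  have hsmall : ∀ᶠ h : ℝ in 𝓝[≠] 0, |ω * h| < δ :=
    nhdsWithin_le_nhds (((continuous_const_mul ω).abs.tendsto' (0 : ℝ) 0 (by simp)).eventually_lt_const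
      hδ)
  refine (hlim.congr' ?_).trans_eq ?_
  · filter_upwards [hsmall, self_mem_nhdsWithin] with h hhδ hh
    exact (localTruncationError_eq y x hh
      (hcond' _ (abs_pos.2 (mul_ne_zero hω.ne' hh)) hhδ).2).symm
  · congr 1
    ring
end

section
/- Let ω > 0, let y : ℝ → ℝ be infinitely differentiable, and let x ∈ ℝ. Let δ > 0 and let b0, b1, b2, b3 : {v : 0 < |v| < δ} → ℝ satisfy, for every v in the domain: N(v, b0(v), b1(v), b2(v), b3(v)) = 0 and (∂N/∂v) = 0, (∂²N/∂v²) = 0, (∂³N/∂v³) = 0 at (v, b0(v), b1(v), b2(v), b3(v)). Define, for 0 < |h| < δ/ω, L_h = y(x+4h) + y(x-4h) - 2(y(x+3h)+y(x-3h)) + 2(y(x+2h)+y(x-2h)) - (y(x+h)+y(x-h)) - h^2·[ b3(ωh)(y''(x+3h)+y''(x-3h)) + b2(ωh)(y''(x+2h)+y''(x-2h)) + b1(ωh)(y''(x+h)+y''(x-h)) + b0(ωh)·y''(x) ]. Then L_h / h^10 → (45767/725760)·( y^{(10)}(x) + 4·ω^2·y^{(8)}(x) + 6·ω^4·y^{(6)}(x)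 + 4·ω^6·y^{(4)}(x) + ω^8·y^{(2)}(x) ) as h → 0 with h ≠ 0. -/
open Filter Topology Matrix

/-- The weighted symmetric sum `∑ i, c i * (y (x + i h) + y (x - i h))`, as a function of `h`. -/
noncomputable def symmSum (y : ℝ → ℝ) (x : ℝ) (c : Fin 5 → ℝ) (h : ℝ) : ℝ :=
  ∑ i : Fin 5, c i * (y (x + (i : ℝ) * h) + y (x - (i : ℝ) * h))

/-- The residual of the symmetric two-derivative scheme with half-weights `a` and `b`. -/
noncomputable def schemeResidual (y : ℝ → ℝ) (x : ℝ) (a b : Fin 5 → ℝ) (h : ℝ) : ℝ :=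
  symmSum y x a h - h ^ 2 * symmSum (iteratedDeriv 2 y) x b h

/-- The `n`-th order coefficient (times `n!`) in the expansion of the residual. -/
noncomputable def orderCoeff (a b : Fin 5 → ℝ) (n : ℕ) : ℝ :=
  (1 + (-1) ^ n) * (∑ i : Fin 5, a i * (i : ℝ) ^ n
    - n * (n - 1) * ∑ i : Fin 5, b i * (i : ℝ) ^ (n - 2))

lemma ContDiff.iteratedDeriv_top {f : ℝ → ℝ} (hf : ContDiff ℝ (⊤ : ℕ∞) f) (n : ℕ) :
    ContDiff ℝ (⊤ : ℕ∞) (iteratedDeriv n f) := by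
  rw [iteratedDeriv_eq_iterate]
  exact ContDiff.iterate_deriv n hf

lemma iteratedDeriv_iteratedDeriv (f : ℝ → ℝ) (m n : ℕ) :
    iteratedDeriv m (iteratedDeriv n f) = iteratedDeriv (m + n) f := by
  simp only [iteratedDeriv_eq_iterate, Function.iterate_add_apply]

lemma contDiff_symmSum {y : ℝ → ℝ} (hy : ContDiff ℝ (⊤ : ℕ∞) y) (x : ℝ) (c : Fin 5 → ℝ) :
    ContDiff ℝ (⊤ : ℕ∞) (symmSum y x c) := by
  unfold symmSum
  fun_prop

lemma contDiff_residual {y : ℝ → ℝ} (hy : ContDiff ℝ (⊤ : ℕ∞) y) (x : ℝ) (a b : Fin 5 → ℝ) :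
    ContDiff ℝ (⊤ : ℕ∞) (schemeResidual y x a b) := by
  have h1 := contDiff_symmSum hy x a
  have h2 := contDiff_symmSum (hy.iteratedDeriv_top 2) x b
  unfold schemeResidual
  fun_prop

lemma iteratedDeriv_symmSum_zero {y : ℝ → ℝ} (hy : ContDiff ℝ (⊤ : ℕ∞) y) (x : ℝ)
    (c : Fin 5 → ℝ) (n : ℕ) :
    iteratedDeriv n (symmSum y x c) 0
      = (1 + (-1) ^ n) * (∑ i : Fin 5, c i * (i : ℝ) ^ n) * iteratedDeriv n y x := by
  have hyn : ContDiff ℝ n y := hy.of_le (by exact_mod_cast le_top)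
  have hshift : ∀ r : ℝ, iteratedDeriv n (fun h => y (x + r * h)) 0
      = r ^ n * iteratedDeriv n y x := by
    intro r
    have h1 : ContDiff ℝ n (fun z => y (x + z)) := by fun_prop
    have := congrFun (iteratedDeriv_comp_const_mul h1 r) 0
    simpa [iteratedDeriv_comp_const_add] using this
  have hterm : ∀ i : Fin 5,
      iteratedDeriv n (fun h => c i * (y (x + (i : ℝ) * h) + y (x - (i : ℝ) * h))) 0
        = (1 + (-1) ^ n) * (c i * (i : ℝ) ^ n) * iteratedDeriv n y x := by
    intro i
    have h2 := hshift (-(i : ℝ))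
    simp only [neg_mul, ← sub_eq_add_neg] at h2
    rw [iteratedDeriv_const_mul_field, iteratedDeriv_fun_add (by fun_prop) (by fun_prop),
      hshift, h2, neg_pow]
    ring
  unfold symmSum
  rw [iteratedDeriv_fun_sum (fun i _ => by fun_prop), Finset.sum_congr rfl fun i _ => hterm i,
    ← Finset.sum_mul, ← Finset.mul_sum]

lemma iteratedDeriv_sq_mul_zero {g : ℝ → ℝ} (hg : ContDiff ℝ (⊤ : ℕ∞) g) (n : ℕ) :
    iteratedDeriv n (fun h => h ^ 2 * g h) 0 = n * (n - 1) * iteratedDeriv (n - 2) g 0 := by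
  have hgn : ContDiff ℝ n g := hg.of_le (by exact_mod_cast le_top)
  rw [iteratedDeriv_fun_mul (by fun_prop) (by fun_prop)]
  simp only [iteratedDeriv_fun_pow_zero, Nat.cast_ite, Nat.cast_zero, mul_ite, ite_mul, mul_zero,
    zero_mul, Finset.sum_ite_eq', Finset.mem_range]
  split_ifs with h
  · rw [Nat.cast_choose_two]
    norm_num
  · have : n = 0 ∨ n = 1 := by omega
    rcases this with rfl | rfl <;> simp

lemma iteratedDeriv_residual_zero {y : ℝ → ℝ} (hy : ContDiff ℝ (⊤ : ℕ∞) y) (x : ℝ)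
    (a b : Fin 5 → ℝ) (n : ℕ) :
    iteratedDeriv n (schemeResidual y x a b) 0 = orderCoeff a b n * iteratedDeriv n y x := by
  have h1 : ContDiff ℝ n (symmSum y x a) :=
    (contDiff_symmSum hy x a).of_le (by exact_mod_cast le_top)
  have h2' := contDiff_symmSum (hy.iteratedDeriv_top 2) x b
  have h2 : ContDiff ℝ n (symmSum (iteratedDeriv 2 y) x b) :=
    h2'.of_le (by exact_mod_cast le_top)
  unfold schemeResidual orderCoeff
  rw [iteratedDeriv_fun_sub (by fun_prop) (by fun_prop), iteratedDeriv_sq_mul_zero h2',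
    iteratedDeriv_symmSum_zero hy, iteratedDeriv_symmSum_zero (hy.iteratedDeriv_top 2),
    iteratedDeriv_iteratedDeriv]
  rcases n with _ | _ | n
  · simp
  · simp
  · rw [show n + 1 + 1 - 2 = n by omega]
    ring

lemma tendsto_div_pow_of_iteratedDeriv_eq_zero {f : ℝ → ℝ} (hf : ContDiff ℝ (⊤ : ℕ∞) f) (n : ℕ)
    (h0 : ∀ i < n, iteratedDeriv i f 0 = 0) :
    Tendsto (fun v => f v / v ^ n) (𝓝[≠] 0) (𝓝 (iteratedDeriv n f 0 / n.factorial)) := by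
  have hT := Real.taylor_tendsto (f := f) (n := n) convex_univ (Set.mem_univ (0 : ℝ))
    (hf.of_le (by exact_mod_cast le_top)).contDiffOn
  rw [nhdsWithin_univ] at hT
  have hT' := (hT.mono_left (nhdsWithin_le_nhds (s := {(0 : ℝ)}ᶜ))).add_const
    (iteratedDeriv n f 0 / n.factorial)
  rw [zero_add] at hT'
  refine hT'.congr' ?_
  filter_upwards [self_mem_nhdsWithin] with v hv
  have hv : v ≠ 0 := hv
  rw [taylor_within_apply, Finset.sum_range_succ, Finset.sum_eq_zero]
  · simp only [iteratedDerivWithin_univ, sub_zero, smul_eq_mul, zero_add]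
    field_simp
    ring
  · intro i hi
    rw [iteratedDerivWithin_univ, h0 i (Finset.mem_range.mp hi), smul_zero]

lemma tendsto_pow_mul_iteratedDeriv_div_pow {f : ℝ → ℝ} (hf : ContDiff ℝ (⊤ : ℕ∞) f) (n j : ℕ)
    (h0 : ∀ i < n, iteratedDeriv i f 0 = 0) :
    Tendsto (fun v => v ^ j * iteratedDeriv j f v / v ^ n) (𝓝[≠] 0)
      (𝓝 (n.descFactorial j * (iteratedDeriv n f 0 / n.factorial))) := by
  rcases le_or_gt j n with hj | hj
  · obtain ⟨m, rfl⟩ := Nat.exists_eq_add_of_le hj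
    have key := tendsto_div_pow_of_iteratedDeriv_eq_zero (hf.iteratedDeriv_top j) m (fun i hi => by
      rw [iteratedDeriv_iteratedDeriv]; exact h0 _ (by omega))
    rw [iteratedDeriv_iteratedDeriv, add_comm m j] at key
    have hfac : ((m.factorial : ℝ)) * ((j + m).descFactorial j : ℝ) = (j + m).factorial := by
      have := Nat.factorial_mul_descFactorial (Nat.le_add_right j m)
      rw [Nat.add_sub_cancel_left] at this
      exact_mod_cast this
    have hm : (m.factorial : ℝ) ≠ 0 := by positivity
    have hjm : ((j + m).factorial : ℝ) ≠ 0 := by positivity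
    convert key.congr' (f₂ := fun v => v ^ j * iteratedDeriv j f v / v ^ (j + m)) ?_ using 2
    · field_simp
      rw [← hfac]
      ring
    · filter_upwards [self_mem_nhdsWithin] with v hv
      have hv : v ≠ 0 := hv
      rw [pow_add, mul_div_mul_left _ _ (pow_ne_zero j hv)]
  · rw [Nat.descFactorial_eq_zero_iff_lt.mpr hj, Nat.cast_zero, zero_mul]
    have hc : Tendsto (fun v : ℝ => v ^ (j - n) * iteratedDeriv j f v) (𝓝[≠] 0) (𝓝 0) := by
      have hcont : Continuous fun v : ℝ => v ^ (j - n) * iteratedDeriv j f v :=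
        (continuous_pow _).mul (hf.iteratedDeriv_top j).continuous
      have := hcont.tendsto 0
      rw [zero_pow (by omega), zero_mul] at this
      exact this.mono_left nhdsWithin_le_nhds
    refine hc.congr' ?_
    filter_upwards [self_mem_nhdsWithin] with v hv
    have hv : v ≠ 0 := hv
    rw [pow_sub₀ v hv hj.le]
    field_simp

lemma tendsto_residual {y : ℝ → ℝ} (hy : ContDiff ℝ (⊤ : ℕ∞) y) (x : ℝ) (a b : Fin 5 → ℝ)
    (n j : ℕ) (h0 : ∀ i < n, orderCoeff a b i = 0) :
    Tendsto (fun v => v ^ j * iteratedDeriv j (schemeResidual y x a b) v / v ^ n) (𝓝[≠] 0)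
      (𝓝 (n.descFactorial j * (orderCoeff a b n * iteratedDeriv n y x / n.factorial))) := by
  have := tendsto_pow_mul_iteratedDeriv_div_pow (contDiff_residual hy x a b) n j
    (fun i hi => by rw [iteratedDeriv_residual_zero hy, h0 i hi, zero_mul])
  rwa [iteratedDeriv_residual_zero hy] at this

lemma tendsto_of_mulVec_eq_s18 {α ι : Type*} [Fintype ι] [DecidableEq ι] {l : Filter α}
    {A : α → Matrix ι ι ℝ} {u g : α → ι → ℝ} {A₀ : Matrix ι ι ℝ} {u₀ : ι → ℝ}
    (hA : Tendsto A l (𝓝 A₀)) (hg : Tendsto g l (𝓝 (A₀ *ᵥ u₀))) (hdet : A₀.det ≠ 0)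
    (h : ∀ᶠ v in l, A v *ᵥ u v = g v) : Tendsto u l (𝓝 u₀) := by
  have hd : Tendsto (fun v => (A v).det) l (𝓝 A₀.det) :=
    ((continuous_id.matrix_det).tendsto A₀).comp hA
  have hadj : Tendsto (fun v => (A v).adjugate) l (𝓝 A₀.adjugate) :=
    ((continuous_id.matrix_adjugate).tendsto A₀).comp hA
  have hmv : Tendsto (fun v => (A v).adjugate *ᵥ g v) l (𝓝 (A₀.adjugate *ᵥ (A₀ *ᵥ u₀))) :=
    tendsto_pi_nhds.mpr fun i => tendsto_finsetSum _ fun k _ =>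
      (tendsto_pi_nhds.mp (tendsto_pi_nhds.mp hadj i) k).mul (tendsto_pi_nhds.mp hg k)
  have hlim := (hd.inv₀ hdet).smul hmv
  rw [mulVec_mulVec, adjugate_mul, smul_mulVec, one_mulVec, inv_smul_smul₀ hdet] at hlim
  refine hlim.congr' ?_
  filter_upwards [h, hd.eventually_ne hdet] with v hv hdv
  rw [← hv, mulVec_mulVec, adjugate_mul, smul_mulVec, one_mulVec, inv_smul_smul₀ hdv]

lemma residual_add_sum (y : ℝ → ℝ) (x : ℝ) (a b : Fin 5 → ℝ) (d : Fin 4 → Fin 5 → ℝ)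
    (τ : Fin 4 → ℝ) (h : ℝ) :
    schemeResidual y x a (b + ∑ k, τ k • d k) h
      = schemeResidual y x a b h + ∑ k, τ k * schemeResidual y x 0 (d k) h := by
  simp only [schemeResidual, symmSum, Fin.sum_univ_five, Fin.sum_univ_four, Pi.add_apply, Pi.smul_apply,
    Pi.zero_apply, smul_eq_mul]
  ring

lemma iteratedDeriv_residual_add_sum {y : ℝ → ℝ} (hy : ContDiff ℝ (⊤ : ℕ∞) y) (x : ℝ)
    (a b : Fin 5 → ℝ) (d : Fin 4 → Fin 5 → ℝ) (τ : Fin 4 → ℝ) (j : ℕ) (v : ℝ) :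
    iteratedDeriv j (schemeResidual y x a (b + ∑ k, τ k • d k)) v
      = iteratedDeriv j (schemeResidual y x a b) v
        + ∑ k, τ k * iteratedDeriv j (schemeResidual y x 0 (d k)) v := by
  have h1 : ∀ a b, ContDiff ℝ j (schemeResidual y x a b) := fun a b =>
    (contDiff_residual hy x a b).of_le (by exact_mod_cast le_top)
  have h2 := h1 a b
  have h3 := fun k => h1 0 (d k)
  rw [funext (residual_add_sum y x a b d τ),
    iteratedDeriv_fun_add (by fun_prop) (by fun_prop),
    iteratedDeriv_fun_sum (fun k _ => by fun_prop)]
  simp only [iteratedDeriv_const_mul_field]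

/-- Half-weights of the function values in the eight-step method. -/
noncomputable def valueWeights : Fin 5 → ℝ := ![0, -1, 2, -2, 1]

/-- Half-weights of the classical eighth-order method with constant coefficients. -/
noncomputable def classicalWeights : Fin 5 → ℝ :=
  ![-50516 / 24192, 61449 / 12096, -23622 / 12096, 17671 / 12096, 0]

/-- Half-weights of the central differences of order `0, 2, 4, 6`. -/
noncomputable def centralDiff : Fin 4 → Fin 5 → ℝ :=
  ![![1 / 2, 0, 0, 0, 0], ![-1, 1, 0, 0, 0], ![3, -4, 1, 0, 0], ![-10, 15, -6, 1, 0]]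

/-- Coordinates of the weights `b` relative to the classical ones in the basis `centralDiff`. -/
noncomputable def diffCoord (b0 b1 b2 b3 : ℝ) : Fin 4 → ℝ :=
  let t3 := b3 - 17671 / 12096
  let t2 := b2 + 23622 / 12096 + 6 * t3
  let t1 := b1 - 61449 / 12096 - 15 * t3 + 4 * t2
  ![b0 + 50516 / 12096 + 20 * t3 - 6 * t2 + 2 * t1, t1, t2, t3]

lemma weights_eq (b0 b1 b2 b3 : ℝ) :
    (![b0 / 2, b1, b2, b3, 0] : Fin 5 → ℝ)
      = classicalWeights + ∑ k, diffCoord b0 b1 b2 b3 k • centralDiff k := by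
  ext i
  fin_cases i <;>
    simp [classicalWeights, centralDiff, diffCoord, Fin.sum_univ_four] <;> ring

lemma N_eq_residual (w b0 b1 b2 b3 : ℝ) :
    N w b0 b1 b2 b3 = schemeResidual Real.cos 0 valueWeights ![b0 / 2, b1, b2, b3, 0] w := by
  have h2 : iteratedDeriv 2 Real.cos = fun t => -Real.cos t := by
    ext t
    simp
  have h4 : Real.cos (4 * w) = 2 * (2 * Real.cos w ^ 2 - 1) ^ 2 - 1 := by
    rw [← Real.cos_two_mul, ← Real.cos_two_mul]
    ring_nf
  simp [N, schemeResidual, symmSum, valueWeights, Fin.sum_univ_five, h2, h4, Real.cos_two_mul,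
    Real.cos_three_mul]
  ring

lemma orderCoeff_classical_eq_zero {n : ℕ} (hn : n < 10) :
    orderCoeff valueWeights classicalWeights n = 0 := by
  interval_cases n <;>
    simp [orderCoeff, valueWeights, classicalWeights, Fin.sum_univ_five] <;> norm_num

lemma orderCoeff_classical_ten :
    orderCoeff valueWeights classicalWeights 10 = 45767 / 725760 * (Nat.factorial 10) := by
  simp [orderCoeff, valueWeights, classicalWeights, Fin.sum_univ_five, Nat.factorial]
  norm_num

lemma orderCoeff_centralDiff_eq_zero (k : Fin 4) {n : ℕ} (hn : n < 2 * k + 2) :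
    orderCoeff 0 (centralDiff k) n = 0 := by
  fin_cases k <;> simp only [Fin.zero_eta, Fin.mk_one, Fin.reduceFinMk, Fin.isValue] at hn ⊢ <;>
    norm_num at hn <;> interval_cases n <;>
    simp [orderCoeff, centralDiff, Fin.sum_univ_five] <;> norm_num

lemma orderCoeff_centralDiff (k : Fin 4) :
    orderCoeff 0 (centralDiff k) (2 * k + 2) = -(Nat.factorial (2 * k + 2)) := by
  fin_cases k <;> simp [orderCoeff, centralDiff, Fin.sum_univ_five, Nat.factorial] <;> norm_num

lemma tendsto_residual_classical {y : ℝ → ℝ} (hy : ContDiff ℝ (⊤ : ℕ∞) y) (x : ℝ) (j : ℕ) :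
    Tendsto (fun v => v ^ j * iteratedDeriv j (schemeResidual y x valueWeights classicalWeights) v
        / v ^ 10) (𝓝[≠] 0)
      (𝓝 (Nat.descFactorial 10 j * (45767 / 725760 * iteratedDeriv 10 y x))) := by
  convert tendsto_residual hy x valueWeights classicalWeights 10 j
    (fun i hi => orderCoeff_classical_eq_zero hi) using 3
  rw [orderCoeff_classical_ten]
  field_simp

lemma tendsto_residual_centralDiff {y : ℝ → ℝ} (hy : ContDiff ℝ (⊤ : ℕ∞) y) (x : ℝ) (j : ℕ)
    (k : Fin 4) :
    Tendsto (fun v => v ^ j * iteratedDeriv j (schemeResidual y x 0 (centralDiff k)) v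
        / v ^ (2 * (k : ℕ) + 2)) (𝓝[≠] 0)
      (𝓝 (Nat.descFactorial (2 * k + 2) j * -iteratedDeriv (2 * k + 2) y x)) := by
  convert tendsto_residual hy x 0 (centralDiff k) (2 * k + 2) j
    (fun i hi => orderCoeff_centralDiff_eq_zero k hi) using 3
  rw [orderCoeff_centralDiff]
  field_simp

/-- Vanishing of the phase-lag and its first three derivatives determines the leading behaviour
of the coefficients in the basis of central differences. -/
lemma tendsto_diffCoord {δ : ℝ} (hδ : 0 < δ) {b0 b1 b2 b3 : ℝ → ℝ}
    (hcond : ∀ v : ℝ, 0 < |v| → |v| < δ → ∀ j : Fin 4,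
      iteratedDeriv j (fun w => N w (b0 v) (b1 v) (b2 v) (b3 v)) v = 0) :
    Tendsto (fun v => fun k : Fin 4 =>
        diffCoord (b0 v) (b1 v) (b2 v) (b3 v) k / v ^ (8 - 2 * (k : ℕ))) (𝓝[≠] 0)
      (𝓝 ((-(45767 / 725760) : ℝ) • ![1, 4, 6, 4])) := by
  have hcos : ContDiff ℝ (⊤ : ℕ∞) Real.cos := Real.contDiff_cos
  have heven : ∀ m : ℕ, iteratedDeriv (2 * m) Real.cos 0 = (-1) ^ m := fun m => by
    rw [Real.iteratedDeriv_even_cos]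
    simp
  have hA : Tendsto (fun v => Matrix.of fun j k : Fin 4 =>
      v ^ (j : ℕ) * iteratedDeriv j (schemeResidual Real.cos 0 0 (centralDiff k)) v
        / v ^ (2 * (k : ℕ) + 2)) (𝓝[≠] 0)
      (𝓝 (Matrix.of fun j k : Fin 4 => (Nat.descFactorial (2 * k + 2) j : ℝ) * (-1) ^ (k : ℕ))) := by
    refine tendsto_pi_nhds.mpr fun j => tendsto_pi_nhds.mpr fun k => ?_
    have hk : iteratedDeriv (2 * (k : ℕ) + 2) Real.cos 0 = -(-1) ^ (k : ℕ) := by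
      rw [show 2 * (k : ℕ) + 2 = 2 * (k + 1) by ring, heven, pow_succ]
      ring
    have hlim := tendsto_residual_centralDiff hcos 0 j k
    rw [hk, neg_neg] at hlim
    exact hlim
  have hg : Tendsto (fun v => fun j : Fin 4 =>
      -(v ^ (j : ℕ) * iteratedDeriv j (schemeResidual Real.cos 0 valueWeights classicalWeights) v
        / v ^ 10)) (𝓝[≠] 0)
      (𝓝 fun j => (Nat.descFactorial 10 j : ℝ) * (45767 / 725760)) := by
    refine tendsto_pi_nhds.mpr fun j => ?_
    convert (tendsto_residual_classical hcos 0 j).neg using 2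
    rw [show 10 = 2 * 5 by norm_num, heven]
    ring
  refine tendsto_of_mulVec_eq_s18 hA ?_ ?_ ?_
    (g := fun v => fun j : Fin 4 =>
      -(v ^ (j : ℕ) * iteratedDeriv j (schemeResidual Real.cos 0 valueWeights classicalWeights) v
        / v ^ 10))
  · convert hg using 2
    ext j
    fin_cases j <;>
      simp [Matrix.mulVec, dotProduct, Fin.sum_univ_four, Nat.descFactorial] <;> norm_num
  · simp [Matrix.det_succ_row_zero, Fin.sum_univ_succ, Nat.descFactorial, Fin.succAbove]
    norm_num
  · have hnear : ∀ᶠ v : ℝ in 𝓝[≠] 0, |v| < δ :=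
      (continuous_abs.tendsto' (0 : ℝ) 0 abs_zero).mono_left nhdsWithin_le_nhds
        |>.eventually_lt_const hδ
    filter_upwards [self_mem_nhdsWithin, hnear] with v hv hvδ
    have hv : v ≠ 0 := hv
    ext j
    have hj := hcond v (abs_pos.mpr hv) hvδ j
    simp only [N_eq_residual, weights_eq] at hj
    rw [iteratedDeriv_residual_add_sum hcos] at hj
    rw [eq_neg_of_add_eq_zero_left hj]
    simp only [Matrix.mulVec, dotProduct, Matrix.of_apply, mul_neg, neg_div, neg_neg,
      Finset.mul_sum, Finset.sum_div]
    refine Finset.sum_congr rfl fun k _ => ?_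
    rw [div_mul_div_comm, ← pow_add, show 2 * (k : ℕ) + 2 + (8 - 2 * k) = 10 by omega]
    ring

/-- The principal term of the local truncation error of the method with zero
phase-lag and zero first, second and third derivatives of the phase-lag is
`(45767/725760) · h^10 · (y⁽¹⁰⁾ + 4ω² y⁽⁸⁾ + 6ω⁴ y⁽⁶⁾ + 4ω⁶ y⁽⁴⁾ + ω⁸ y⁽²⁾)`. -/
theorem zero_PL_three_derivs_method_principal_LTE
    (ω : ℝ) (hω : 0 < ω) (y : ℝ → ℝ) (hy : ContDiff ℝ (⊤ : ℕ∞) y) (x : ℝ)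
    (δ : ℝ) (hδ : 0 < δ) (b0 b1 b2 b3 : ℝ → ℝ)
    (hcond : ∀ v : ℝ, 0 < |v| → |v| < δ →
      N v (b0 v) (b1 v) (b2 v) (b3 v) = 0 ∧
      deriv (fun w => N w (b0 v) (b1 v) (b2 v) (b3 v)) v = 0 ∧
      iteratedDeriv 2 (fun w => N w (b0 v) (b1 v) (b2 v) (b3 v)) v = 0 ∧
      iteratedDeriv 3 (fun w => N w (b0 v) (b1 v) (b2 v) (b3 v)) v = 0) :
    Filter.Tendsto
      (fun h : ℝ =>
        (y (x + 4 * h) + y (x - 4 * h)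
          - 2 * (y (x + 3 * h) + y (x - 3 * h))
          + 2 * (y (x + 2 * h) + y (x - 2 * h))
          - (y (x + h) + y (x - h))
          - h ^ 2 *
            (b3 (ω * h) * (iteratedDeriv 2 y (x + 3 * h) + iteratedDeriv 2 y (x - 3 * h))
              + b2 (ω * h) * (iteratedDeriv 2 y (x + 2 * h) + iteratedDeriv 2 y (x - 2 * h))
              + b1 (ω * h) * (iteratedDeriv 2 y (x + h) + iteratedDeriv 2 y (x - h))
              + b0 (ω * h) * iteratedDeriv 2 y x)) / h ^ 10)
      (nhdsWithin 0 {(0 : ℝ)}ᶜ)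
      (nhds ((45767 / 725760) *
        (iteratedDeriv 10 y x + 4 * ω ^ 2 * iteratedDeriv 8 y x
          + 6 * ω ^ 4 * iteratedDeriv 6 y x + 4 * ω ^ 6 * iteratedDeriv 4 y x
          + ω ^ 8 * iteratedDeriv 2 y x))) := by
  have hcoord := tendsto_diffCoord hδ (b0 := b0) (b1 := b1) (b2 := b2) (b3 := b3)
    fun v hv hvδ j => by
      obtain ⟨h0, h1, h2, h3⟩ := hcond v hv hvδ
      fin_cases j
      · simpa using h0
      · simpa using h1
      · exact h2
      · exact h3
  have hscale : Tendsto (fun h : ℝ => ω * h) (𝓝[≠] 0) (𝓝[≠] 0) := by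
    refine tendsto_nhdsWithin_iff.mpr ⟨?_, ?_⟩
    · exact ((continuous_const_mul ω).tendsto' 0 0 (mul_zero ω)).mono_left nhdsWithin_le_nhds
    · filter_upwards [self_mem_nhdsWithin] with h hh
      exact mul_ne_zero hω.ne' hh
  have hclass := tendsto_residual_classical hy x 0
  have hterm : ∀ k : Fin 4, Tendsto
      (fun h => ω ^ (8 - 2 * (k : ℕ))
        * (diffCoord (b0 (ω * h)) (b1 (ω * h)) (b2 (ω * h)) (b3 (ω * h)) k
          / (ω * h) ^ (8 - 2 * (k : ℕ)))
        * (h ^ 0 * iteratedDeriv 0 (schemeResidual y x 0 (centralDiff k)) h / h ^ (2 * (k : ℕ) + 2)))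
      (𝓝[≠] 0) _ := fun k =>
    (((tendsto_pi_nhds.mp hcoord k).comp hscale).const_mul _).mul
      (tendsto_residual_centralDiff hy x 0 k)
  have hsum := hclass.add (tendsto_finsetSum Finset.univ fun k _ => hterm k)
  convert hsum.congr' ?_ using 2
  · simp [Fin.sum_univ_four]
    ring
  · filter_upwards [self_mem_nhdsWithin] with h hh
    have hh : h ≠ 0 := hh
    have hω' := hω.ne'
    trans schemeResidual y x valueWeights
      ![b0 (ω * h) / 2, b1 (ω * h), b2 (ω * h), b3 (ω * h), 0] h / h ^ 10
    · rw [weights_eq, residual_add_sum, add_div, Finset.sum_div]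
      congr 1
      · simp
      · refine Finset.sum_congr rfl fun k _ => ?_
        rw [show h ^ 10 = h ^ (8 - 2 * (k : ℕ)) * h ^ (2 * (k : ℕ) + 2) by
          rw [← pow_add]; congr 1; omega, mul_pow]
        simp only [iteratedDeriv_zero, pow_zero, one_mul]
        field_simp
    · congr 1
      simp [schemeResidual, symmSum, valueWeights, Fin.sum_univ_five]
      ring
end
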